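/- arXiv:2401.09554 — 10 statements merged into one kernel-verified Lean document; each statement's English description precedes it below -/
import Mathlib

section
/- Let q : ℕ → ℝ be a nonincreasing probability sequence (0 ≤ q n for all n, q (n+1) ≤ q n for all n, and ∑' n, q n = 1), and for k ∈ ℕ let T q k := ∑' n, q (k + n) denote its k-th tail sum. Then, as an identity in the extended nonnegative reals, ∫⁻ μ in Set.Ioo (0:ℝ) 1, (ENNReal.ofReal μ)⁻¹ * (⨅ k : ℕ, ENNReal.ofReal (T q k + k * μ)) ∂volume = 1 + ∑' n, ENNReal.ofReal (Real.negMulLog (q n)). -/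
open MeasureTheory

lemma aux_single (a : ℝ) (h0 : 0 ≤ a) (h1 : a ≤ 1) :
    ∫⁻ μ in Set.Ioo (0 : ℝ) 1, (ENNReal.ofReal μ)⁻¹ * ENNReal.ofReal (min a μ) ∂volume
      = ENNReal.ofReal a + ENNReal.ofReal (Real.negMulLog a) := by
  rcases h0.eq_or_lt with rfl | ha
  · rw [setLIntegral_congr_fun (g := fun _ => 0) measurableSet_Ioo]
    · simp
    · intro x hx
      simp [min_eq_left hx.1.le]
  rw [setLIntegral_congr Ioo_ae_eq_Ioc, ← Set.Ioc_union_Ioc_eq_Ioc h0 h1,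
    lintegral_union measurableSet_Ioc (Set.Ioc_disjoint_Ioc_of_le le_rfl)]
  congr 1
  · rw [setLIntegral_congr_fun (g := fun _ => 1) measurableSet_Ioc]
    · simp
    · intro x hx
      have : ENNReal.ofReal x ≠ 0 := by simpa using hx.1
      simp only [min_eq_right hx.2]
      exact ENNReal.inv_mul_cancel this ENNReal.ofReal_ne_top
  · rw [setLIntegral_congr_fun (g := fun x => ENNReal.ofReal (a * x⁻¹)) measurableSet_Ioc]
    · have hint : IntervalIntegrable (fun x : ℝ => a * x⁻¹) volume a 1 := by
        apply IntervalIntegrable.const_mul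
        apply intervalIntegral.intervalIntegrable_inv
        · intro x hx
          rw [Set.uIcc_of_le h1] at hx
          exact (ha.trans_le hx.1).ne'
        · exact continuousOn_id
      rw [← ofReal_integral_eq_lintegral_ofReal]
      · rw [← intervalIntegral.integral_of_le h1, intervalIntegral.integral_const_mul,
          integral_inv_of_pos ha one_pos]
        simp [Real.negMulLog]
      · exact (intervalIntegrable_iff_integrableOn_Ioc_of_le h1).1 hint
      · filter_upwards [ae_restrict_mem measurableSet_Ioc] with x hx
        have := ha.trans hx.1
        simp only [Pi.zero_apply]
        positivity
    · intro x hx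
      have hx0 := ha.trans hx.1
      simp only [min_eq_left hx.1.le]
      rw [← ENNReal.ofReal_inv_of_pos hx0, ENNReal.ofReal_mul h0, mul_comm]

lemma aux_inf (q : ℕ → ℝ) (hq0 : ∀ n, 0 ≤ q n) (hqmono : ∀ n, q (n + 1) ≤ q n)
    (hs : Summable q) (μ : ℝ) (hμ : 0 < μ) :
    (⨅ k : ℕ, ENNReal.ofReal ((∑' n, q (k + n)) + k * μ))
      = ∑' n, ENNReal.ofReal (min (q n) μ) := by
  have hanti : Antitone q := antitone_nat_of_succ_le hqmono
  have key : ∀ k : ℕ, ENNReal.ofReal ((∑' n, q (k + n)) + k * μ)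
      = ∑ n ∈ Finset.range k, ENNReal.ofReal μ + ∑' n, ENNReal.ofReal (q (n + k)) := by
    intro k
    have hsk : Summable fun n => q (n + k) := (summable_nat_add_iff k).2 hs
    rw [ENNReal.ofReal_add (tsum_nonneg fun n => hq0 _) (by positivity), add_comm]
    congr 1
    · rw [ENNReal.ofReal_mul (by positivity)]
      simp
    · simp_rw [add_comm k]
      exact ENNReal.ofReal_tsum_of_nonneg (fun n => hq0 _) hsk
  have split : ∀ k : ℕ, ∑' n, ENNReal.ofReal (min (q n) μ)
      = ∑ n ∈ Finset.range k, ENNReal.ofReal (min (q n) μ)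
        + ∑' n, ENNReal.ofReal (min (q (n + k)) μ) := by
    intro k
    exact (Summable.sum_add_tsum_nat_add' (f := fun n => ENNReal.ofReal (min (q n) μ))
      (k := k) ENNReal.summable).symm
  apply le_antisymm
  · have hex : ∃ k, q k ≤ μ :=
      ((hs.tendsto_atTop_zero.eventually (eventually_le_nhds hμ))).exists
    obtain ⟨k, hk1, hk2⟩ : ∃ k, q k ≤ μ ∧ ∀ n < k, μ ≤ q n := by
      classical
      exact ⟨Nat.find hex, Nat.find_spec hex,
        fun n hn => (not_le.1 (Nat.find_min hex hn)).le⟩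
    refine (iInf_le _ k).trans ?_
    rw [key k, split k]
    refine add_le_add (Finset.sum_le_sum fun n hn => ?_) (ENNReal.tsum_le_tsum fun n => ?_)
    · exact ENNReal.ofReal_le_ofReal (le_min (hk2 n (Finset.mem_range.1 hn)) le_rfl)
    · exact ENNReal.ofReal_le_ofReal
        (le_min le_rfl ((hanti (Nat.le_add_left _ _)).trans hk1))
  · refine le_iInf fun k => ?_
    rw [key k, split k]
    refine add_le_add (Finset.sum_le_sum fun n hn => ?_) (ENNReal.tsum_le_tsum fun n => ?_)
    · exact ENNReal.ofReal_le_ofReal (min_le_right _ _)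
    · exact ENNReal.ofReal_le_ofReal (min_le_left _ _)

/-- Integral representation of the Shannon entropy (in nats) of a nonincreasing
probability sequence `q`, where `T q k = ∑' n, q (k + n)` is the `k`-th tail sum. -/
theorem integral_representation_entropy
    (q : ℕ → ℝ) (hq0 : ∀ n, 0 ≤ q n) (hqmono : ∀ n, q (n + 1) ≤ q n)
    (hqsum : ∑' n, q n = 1) :
    ∫⁻ μ in Set.Ioo (0 : ℝ) 1,
        (ENNReal.ofReal μ)⁻¹ *
          (⨅ k : ℕ, ENNReal.ofReal ((∑' n, q (k + n)) + k * μ)) ∂volume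
      = 1 + ∑' n, ENNReal.ofReal (Real.negMulLog (q n)) := by
  have hs : Summable q := by
    by_contra h
    rw [tsum_eq_zero_of_not_summable h] at hqsum
    exact zero_ne_one hqsum
  have hle : ∀ n, q n ≤ 1 := fun n => hqsum ▸ hs.le_tsum n (fun j _ => hq0 j)
  rw [setLIntegral_congr_fun (g := fun μ => ∑' n, (ENNReal.ofReal μ)⁻¹ *
    ENNReal.ofReal (min (q n) μ)) measurableSet_Ioo]
  · rw [lintegral_tsum (fun n => by fun_prop)]
    simp_rw [fun n => aux_single (q n) (hq0 n) (hle n)]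
    rw [ENNReal.tsum_add, ← ENNReal.ofReal_tsum_of_nonneg hq0 hs, hqsum, ENNReal.ofReal_one]
  · intro μ hμ
    simp only [aux_inf q hq0 hqmono hs μ hμ.1, ENNReal.tsum_mul_left]
end

section
/- Let q : ℕ → ℝ be a nonincreasing probability sequence, let w : ℕ → ℝ be a probability sequence, and let ω : ℕ → ℕ → ℝ be a family such that ω x is a nonincreasing probability sequence for every x. Assume the tail-sum (majorization) inequalities: for every N ∈ ℕ, ∑' n, q (N + n) ≥ ∑' x, w x * (∑' n, ω x (N + n)). Then the entropies satisfy, in the extended nonnegative reals, ∑' n, ENNReal.ofReal (Real.negMulLog (q n)) ≥ ∑' x, ENNReal.ofReal (w x) * (∑' n, ENNReal.ofReal (Real.negMulLog (ω x n))). -/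
open scoped ENNReal

/-- Cost function `-log q`, with value `⊤` where `q` vanishes. -/
noncomputable def entCost (q : ℕ → ℝ) (n : ℕ) : ℝ≥0∞ :=
  if q n = 0 then ⊤ else ENNReal.ofReal (-Real.log (q n))

lemma entCost_mono (q : ℕ → ℝ) (hq0 : ∀ n, 0 ≤ q n) (hqmono : ∀ n, q (n + 1) ≤ q n) :
    Monotone (entCost q) := by
  refine monotone_nat_of_le_succ fun n => ?_
  unfold entCost
  by_cases h1 : q (n + 1) = 0
  · simp [h1]
  · have hp : 0 < q (n + 1) := lt_of_le_of_ne (hq0 _) (Ne.symm h1)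
    have hp2 : 0 < q n := hp.trans_le (hqmono n)
    rw [if_neg h1, if_neg hp2.ne']
    exact ENNReal.ofReal_le_ofReal (neg_le_neg (Real.log_le_log hp (hqmono n)))

lemma mul_entCost (q : ℕ → ℝ) (hq0 : ∀ n, 0 ≤ q n) (n : ℕ) :
    ENNReal.ofReal (q n) * entCost q n = ENNReal.ofReal (Real.negMulLog (q n)) := by
  unfold entCost
  by_cases h : q n = 0
  · simp [h]
  · rw [if_neg h, ← ENNReal.ofReal_mul (hq0 n)]
    congr 1
    simp [Real.negMulLog]

lemma summable_of_tsum_one {p : ℕ → ℝ} (h : ∑' n, p n = 1) : Summable p := by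
  by_contra hc
  rw [tsum_eq_zero_of_not_summable hc] at h
  exact zero_ne_one h

lemma tsum_ofReal_one {p : ℕ → ℝ} (h0 : ∀ n, 0 ≤ p n) (h : ∑' n, p n = 1) :
    ∑' n, ENNReal.ofReal (p n) = 1 := by
  rw [← ENNReal.ofReal_tsum_of_nonneg h0 (summable_of_tsum_one h), h, ENNReal.ofReal_one]

lemma gibbs_pointwise (p q : ℝ) (hp0 : 0 < p) (hq : 0 < q) :
    Real.negMulLog p + p ≤ p * (-Real.log q) + q := by
  have h := Real.log_le_sub_one_of_pos (div_pos hq hp0)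
  rw [Real.log_div hq.ne' hp0.ne'] at h
  have h2 := mul_le_mul_of_nonneg_left h hp0.le
  have h3 : p * (q / p - 1) = q - p := by field_simp
  rw [h3] at h2
  unfold Real.negMulLog
  nlinarith

/-- Gibbs' inequality. -/
lemma gibbs (p q : ℕ → ℝ) (hp0 : ∀ n, 0 ≤ p n) (hp : ∑' n, p n = 1)
    (hq0 : ∀ n, 0 ≤ q n) (hq : ∑' n, q n = 1) :
    ∑' n, ENNReal.ofReal (Real.negMulLog (p n))
      ≤ ∑' n, ENNReal.ofReal (p n) * entCost q n := by
  have hpt : ∀ n, ENNReal.ofReal (Real.negMulLog (p n)) + ENNReal.ofReal (p n)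
      ≤ ENNReal.ofReal (p n) * entCost q n + ENNReal.ofReal (q n) := by
    intro n
    rcases (hp0 n).eq_or_lt with h | h
    · simp [← h]
    unfold entCost
    by_cases h1 : q n = 0
    · have : ENNReal.ofReal (p n) ≠ 0 := by simpa using h
      simp [h1, ENNReal.mul_top this]
    · have hqp : 0 < q n := lt_of_le_of_ne (hq0 _) (Ne.symm h1)
      have hp1 : p n ≤ 1 := hp ▸ (summable_of_tsum_one hp).le_tsum n (fun j _ => hp0 j)
      rw [if_neg h1, ← ENNReal.ofReal_mul h.le,
        ← ENNReal.ofReal_add (Real.negMulLog_nonneg h.le hp1) h.le]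
      exact (ENNReal.ofReal_le_ofReal (gibbs_pointwise _ _ h hqp)).trans ENNReal.ofReal_add_le
  have hs := ENNReal.tsum_le_tsum hpt
  rw [ENNReal.tsum_add, ENNReal.tsum_add, tsum_ofReal_one hp0 hp, tsum_ofReal_one hq0 hq] at hs
  exact (ENNReal.add_le_add_iff_right ENNReal.one_ne_top).1 hs

lemma tail_ite (P : ℕ → ℝ≥0∞) (k : ℕ) :
    ∑' n, (if k ≤ n then P n else 0) = ∑' n, P (k + n) := by
  rw [← (ENNReal.summable (f := fun n => if k ≤ n + k then P (n + k) else 0)).sum_add_tsum_nat_add'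
    (f := fun n => if k ≤ n then P n else 0)]
  rw [Finset.sum_eq_zero]
  · simp [add_comm]
  · intro i hi
    simp [Finset.mem_range.1 hi]

/-- Summation by parts. -/
lemma abel (a : ℕ → ℝ≥0∞) (ha : Monotone a) :
    ∃ e : ℕ → ℝ≥0∞, ∀ P : ℕ → ℝ≥0∞, ∑' n, P n * a n = ∑' k, e k * ∑' n, P (k + n) := by
  let e : ℕ → ℝ≥0∞ := fun k => Nat.casesOn k (a 0) (fun j => a (j + 1) - a j)
  have he : ∀ n, a n = ∑ k ∈ Finset.range (n + 1), e k := by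
    intro n
    induction n with
    | zero => simp [e]
    | succ n ih =>
      rw [Finset.sum_range_succ, ← ih]
      exact (add_tsub_cancel_of_le (ha n.le_succ)).symm
  have he2 : ∀ n, a n = ∑' k, if k ≤ n then e k else 0 := by
    intro n
    rw [he, tsum_eq_sum (s := Finset.range (n + 1))]
    · refine Finset.sum_congr rfl fun k hk => ?_
      rw [if_pos (Nat.lt_succ_iff.1 (Finset.mem_range.1 hk))]
    · intro k hk
      rw [if_neg]
      simpa [Nat.lt_succ_iff] using hk
  refine ⟨e, fun P => ?_⟩
  simp_rw [he2, ← ENNReal.tsum_mul_left]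
  rw [ENNReal.tsum_comm]
  refine tsum_congr fun k => ?_
  rw [ENNReal.tsum_mul_left, ← tail_ite, ← ENNReal.tsum_mul_left]
  refine tsum_congr fun n => ?_
  split_ifs <;> simp [mul_comm]


/-- Conversion of majorization (tail-sum) conditions into the entropy inequality:
if for every `N` the `N`-th tail sum of `q` dominates the `w`-average of the
`N`-th tail sums of the `ω x`, then the entropy of `q` dominates the `w`-average
of the entropies of the `ω x`. -/
theorem entropy_ge_of_tail_sums
    (q : ℕ → ℝ) (hq0 : ∀ n, 0 ≤ q n) (hqmono : ∀ n, q (n + 1) ≤ q n)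
    (hqsum : ∑' n, q n = 1)
    (w : ℕ → ℝ) (hw0 : ∀ x, 0 ≤ w x) (hwsum : ∑' x, w x = 1)
    (ω : ℕ → ℕ → ℝ) (hω0 : ∀ x n, 0 ≤ ω x n)
    (hωmono : ∀ x n, ω x (n + 1) ≤ ω x n) (hωsum : ∀ x, ∑' n, ω x n = 1)
    (hmaj : ∀ N : ℕ, ∑' x, w x * (∑' n, ω x (N + n)) ≤ ∑' n, q (N + n)) :
    ∑' x, ENNReal.ofReal (w x) * (∑' n, ENNReal.ofReal (Real.negMulLog (ω x n)))
      ≤ ∑' n, ENNReal.ofReal (Real.negMulLog (q n)) := by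
  obtain ⟨e, he⟩ := abel (entCost q) (entCost_mono q hq0 hqmono)
  have hqs := summable_of_tsum_one hqsum
  have hws := summable_of_tsum_one hwsum
  have hωs := fun x => summable_of_tsum_one (hωsum x)
  have hinj : ∀ N : ℕ, Function.Injective (fun n => N + n) := fun N => add_right_injective N
  have hωt : ∀ x N, Summable fun n => ω x (N + n) := fun x N => (hωs x).comp_injective (hinj N)
  have hqt : ∀ N, Summable fun n => q (N + n) := fun N => hqs.comp_injective (hinj N)
  have ht0 : ∀ x N, 0 ≤ ∑' n, ω x (N + n) := fun x N => tsum_nonneg fun n => hω0 x _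
  have ht1 : ∀ x N, ∑' n, ω x (N + n) ≤ 1 := fun x N =>
    hωsum x ▸ tsum_comp_le_tsum_of_inj (hωs x) (hω0 x) (hinj N)
  have hmaj' : ∀ N, ∑' n, ∑' x, ENNReal.ofReal (w x) * ENNReal.ofReal (ω x (N + n))
      ≤ ∑' n, ENNReal.ofReal (q (N + n)) := by
    intro N
    rw [ENNReal.tsum_comm]
    simp_rw [ENNReal.tsum_mul_left]
    rw [← ENNReal.ofReal_tsum_of_nonneg (fun n => hq0 _) (hqt N)]
    refine le_trans (le_of_eq ?_) (ENNReal.ofReal_le_ofReal (hmaj N))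
    rw [ENNReal.ofReal_tsum_of_nonneg (fun x => mul_nonneg (hw0 x) (ht0 x N))]
    · refine tsum_congr fun x => ?_
      rw [ENNReal.ofReal_mul (hw0 x), ENNReal.ofReal_tsum_of_nonneg (fun n => hω0 x _) (hωt x N)]
    · exact Summable.of_nonneg_of_le (fun x => mul_nonneg (hw0 x) (ht0 x N))
        (fun x => mul_le_of_le_one_right (hw0 x) (ht1 x N)) hws
  calc ∑' x, ENNReal.ofReal (w x) * (∑' n, ENNReal.ofReal (Real.negMulLog (ω x n)))
      ≤ ∑' x, ENNReal.ofReal (w x) * (∑' n, ENNReal.ofReal (ω x n) * entCost q n) :=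
        ENNReal.tsum_le_tsum fun x =>
          mul_le_mul_right (gibbs (ω x) q (hω0 x) (hωsum x) hq0 hqsum) _
    _ = ∑' n, (∑' x, ENNReal.ofReal (w x) * ENNReal.ofReal (ω x n)) * entCost q n := by
        simp_rw [← ENNReal.tsum_mul_left, ← ENNReal.tsum_mul_right]
        rw [ENNReal.tsum_comm]
        simp_rw [mul_assoc]
    _ = ∑' k, e k * ∑' n, ∑' x, ENNReal.ofReal (w x) * ENNReal.ofReal (ω x (k + n)) := he _
    _ ≤ ∑' k, e k * ∑' n, ENNReal.ofReal (q (k + n)) :=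
        ENNReal.tsum_le_tsum fun k => mul_le_mul_right (hmaj' k) _
    _ = ∑' n, ENNReal.ofReal (q n) * entCost q n := (he (fun n => ENNReal.ofReal (q n))).symm
    _ = ∑' n, ENNReal.ofReal (Real.negMulLog (q n)) := tsum_congr fun n => mul_entCost q hq0 n
end

section
/- Let q : ℕ → ℝ be a nonincreasing probability sequence with q n > 0 for all n, and define q' : ℕ → ℝ by q' 0 = 1 and q' (n+1) = q n. Then, as an identity in the extended nonnegative reals (both sides may be +∞), ∑' n, ENNReal.ofReal (Real.negMulLog (q n)) = ∑' n, ENNReal.ofReal ((Real.log (q' n) − Real.log (q' (n+1))) * (∑' m, q (n + m))). (All summands on both sides are nonnegative since q' is nonincreasing.) -/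
/-- The identity `S(ρ) = ∑ₙ log(pₙ/pₙ₊₁) χ̃ₙ₊₁(ρ)` (in nats, with `p₀ := 1`),
valid whether the entropy is finite or infinite. -/
theorem entropy_eq_sum_log_ratio_mul_tail
    (q : ℕ → ℝ) (hq0 : ∀ n, 0 < q n) (hqmono : ∀ n, q (n + 1) ≤ q n)
    (hqsum : ∑' n, q n = 1)
    (q' : ℕ → ℝ) (hq'0 : q' 0 = 1) (hq'succ : ∀ n, q' (n + 1) = q n) :
    ∑' n, ENNReal.ofReal (Real.negMulLog (q n))
      = ∑' n, ENNReal.ofReal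
          ((Real.log (q' n) - Real.log (q' (n + 1))) * (∑' m, q (n + m))) := by
  have hsm : Summable q := by
    by_contra h
    rw [tsum_eq_zero_of_not_summable h] at hqsum
    exact zero_ne_one hqsum
  have hle : ∀ n, q n ≤ 1 := fun n => hqsum ▸ hsm.le_tsum n (fun j _ => (hq0 j).le)
  have ha : ∀ n, 0 ≤ Real.log (q' n) - Real.log (q' (n + 1)) := by
    intro n
    rw [sub_nonneg]
    cases n with
    | zero =>
      rw [hq'succ, hq'0]
      exact Real.log_le_log (hq0 0) (hle 0)
    | succ k =>
      rw [hq'succ, hq'succ]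
      exact Real.log_le_log (hq0 _) (hqmono k)
  have hR : ∀ n, ENNReal.ofReal
      ((Real.log (q' n) - Real.log (q' (n + 1))) * (∑' m, q (n + m)))
      = ∑' m, ENNReal.ofReal ((Real.log (q' n) - Real.log (q' (n + 1))) * q (n + m)) := by
    intro n
    have hs : Summable fun m => q (n + m) := by
      simpa [add_comm] using (summable_nat_add_iff n).2 hsm
    rw [← tsum_mul_left, ENNReal.ofReal_tsum_of_nonneg
      (fun m => mul_nonneg (ha n) (hq0 _).le) (hs.mul_left _)]
  simp_rw [hR]
  rw [← ENNReal.tsum_prod, ← Finset.HasAntidiagonal.sigmaAntidiagonalEquivProd.tsum_eq,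
    ENNReal.tsum_sigma']
  refine tsum_congr fun k => ?_
  rw [tsum_fintype]
  simp only [Finset.HasAntidiagonal.sigmaAntidiagonalEquivProd_apply]
  rw [Finset.sum_coe_sort (Finset.HasAntidiagonal.antidiagonal k) (fun p : ℕ × ℕ => ENNReal.ofReal
    ((Real.log (q' p.1) - Real.log (q' (p.1 + 1))) * q (p.1 + p.2))),
    ← ENNReal.ofReal_sum_of_nonneg (fun p _ => mul_nonneg (ha _) (hq0 _).le)]
  congr 1
  rw [Finset.Nat.sum_antidiagonal_eq_sum_range_succ_mk]
  have : ∀ i ∈ Finset.range (k + 1),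
      (Real.log (q' i) - Real.log (q' (i + 1))) * q (i + (k - i))
      = (Real.log (q' i) - Real.log (q' (i + 1))) * q k := by
    intro i hi
    rw [Nat.add_sub_cancel' (Nat.lt_succ_iff.1 (Finset.mem_range.1 hi))]
  rw [Finset.sum_congr rfl this, ← Finset.sum_mul,
    Finset.sum_range_sub' (fun i => Real.log (q' i)), hq'0, hq'succ, Real.log_one, Real.negMulLog]
  ring
end

section
/- Let q : ℕ → ℝ be a nonincreasing probability sequence, define q' : ℕ → ℝ by q' 0 = 1 and q' (n+1) = q n, and for k ∈ ℕ let T q k := ∑' m, q (k + m). Then for every n ∈ ℕ and every real μ with q' (n+1) ≤ μ ≤ q' n, the infimum over k ∈ ℕ of the real numbers T q k + k * μ equals T q n + n * μ; in particular the infimum is attained at k = n. -/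
/-- Pointwise evaluation of the infimum in the integral representation of the
entropy: for `μ` between consecutive entries `q' (n+1) ≤ μ ≤ q' n`
(with `q' 0 = 1` and `q' (k+1) = q k`), the infimum over `k` of
`T q k + k * μ` is attained at `k = n`, where `T q k = ∑' m, q (k + m)`. -/
theorem iInf_tail_add_mul_eq
    (q : ℕ → ℝ) (hq0 : ∀ n, 0 ≤ q n) (hqmono : ∀ n, q (n + 1) ≤ q n)
    (hqsum : ∑' n, q n = 1)
    (q' : ℕ → ℝ) (hq'0 : q' 0 = 1) (hq'succ : ∀ n, q' (n + 1) = q n)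
    (n : ℕ) (μ : ℝ) (hμl : q' (n + 1) ≤ μ) (hμu : μ ≤ q' n) :
    ⨅ k : ℕ, ((∑' m, q (k + m)) + k * μ) = (∑' m, q (n + m)) + n * μ := by
  have hs : Summable q := by
    by_contra h
    rw [tsum_eq_zero_of_not_summable h] at hqsum
    exact zero_ne_one hqsum
  have hanti : Antitone q := antitone_nat_of_succ_le hqmono
  have hstep : ∀ k : ℕ, (∑' m, q (k + m)) = q k + ∑' m, q (k + 1 + m) := by
    intro k
    have hk : Summable fun m => q (k + m) := by
      simpa [add_comm] using (summable_nat_add_iff k).2 hs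
    rw [hk.tsum_eq_zero_add]
    simp [add_assoc, add_comm, add_left_comm]
  have hup : ∀ k, n ≤ k →
      (∑' m, q (n + m)) + n * μ ≤ (∑' m, q (k + m)) + k * μ := by
    intro k hk
    induction k, hk using Nat.le_induction with
    | base => exact le_rfl
    | succ k hk ih =>
      have h1 := hstep k
      have h2 := hanti hk
      rw [hq'succ] at hμl
      push_cast
      linarith
  have hdown : ∀ d k, k + d = n →
      (∑' m, q (n + m)) + n * μ ≤ (∑' m, q (k + m)) + k * μ := by
    intro d
    induction d with
    | zero =>
      intro k hk
      obtain rfl : k = n := by omega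
      exact le_rfl
    | succ d ih =>
      intro k hk
      have h0 := ih (k + 1) (by omega)
      have h1 := hstep k
      have h2 : μ ≤ q k := by
        have h3 : n = (k + d) + 1 := by omega
        rw [h3, hq'succ] at hμu
        exact hμu.trans (hanti (by omega))
      push_cast at h0
      linarith
  have hmin : ∀ k : ℕ,
      (∑' m, q (n + m)) + n * μ ≤ (∑' m, q (k + m)) + k * μ := by
    intro k
    rcases le_total n k with h | h
    · exact hup k h
    · exact hdown (n - k) k (by omega)
  apply le_antisymm
  · exact ciInf_le ⟨_, by rintro _ ⟨k, rfl⟩; exact hmin k⟩ n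
  · exact le_ciInf hmin
end

section
/- Let q : ℕ → ℝ be a probability sequence (0 ≤ q n for all n and ∑' n, q n = 1). Then the entropy is finite, ∑' n, ENNReal.ofReal (Real.negMulLog (q n)) < ⊤, if and only if there exists E : ℕ → ℝ such that: (i) 0 ≤ E n for all n and E n₀ = 0 for some n₀ (groundedness); (ii) for every β > 0 the sequence n ↦ Real.exp (−β * E n) is summable (Gibbs hypothesis); and (iii) the sequence n ↦ q n * E n is summable (finite mean energy). -/
lemma exists_growing_weight (b : ℕ → ℝ) (hb : ∀ n, 0 < b n) (hs : Summable b) :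
    ∃ c : ℕ → ℝ, (∀ n, 0 ≤ c n) ∧ Filter.Tendsto c Filter.atTop Filter.atTop ∧
      Summable (fun n => c n * b n) := by
  set r : ℕ → ℝ := fun n => ∑' k, b (k + n) with hr
  have hsn : ∀ n, Summable (fun k => b (k + n)) := fun n => (summable_nat_add_iff n).2 hs
  have hrpos : ∀ n, 0 < r n := fun n =>
    (hsn n).tsum_pos (fun k => (hb _).le) 0 (hb _)
  have hrec : ∀ n, r n = b n + r (n + 1) := by
    intro n
    have h := (hsn n).tsum_eq_zero_add
    simp only [hr]
    rw [h]
    simp only [zero_add]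
    congr 1
    refine tsum_congr fun k => ?_
    congr 1
    omega
  have hlim : Filter.Tendsto r Filter.atTop (nhds 0) := tendsto_sum_nat_add b
  have hsq : ∀ n, 0 < Real.sqrt (r n) := fun n => Real.sqrt_pos.2 (hrpos n)
  refine ⟨fun n => (Real.sqrt (r n))⁻¹, fun n => (inv_pos.2 (hsq n)).le, ?_, ?_⟩
  · apply Filter.Tendsto.inv_tendsto_nhdsGT_zero
    rw [tendsto_nhdsWithin_iff]
    refine ⟨?_, Filter.Eventually.of_forall hsq⟩
    have := (Real.continuous_sqrt.tendsto 0).comp hlim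
    rw [Real.sqrt_zero] at this
    exact this
  · have key : ∀ n, (Real.sqrt (r n))⁻¹ * b n ≤ 2 * (Real.sqrt (r n) - Real.sqrt (r (n + 1))) := by
      intro n
      rw [inv_mul_le_iff₀ (hsq n)]
      have h1 := Real.sq_sqrt (hrpos n).le
      have h2 := Real.sq_sqrt (hrpos (n + 1)).le
      nlinarith [hrec n, sq_nonneg (Real.sqrt (r n) - Real.sqrt (r (n + 1)))]
    refine summable_of_sum_range_le (c := 2 * Real.sqrt (r 0))
      (fun n => mul_nonneg (inv_pos.2 (hsq n)).le (hb n).le) fun n => ?_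
    have h3 := Finset.sum_le_sum (s := Finset.range n) fun i _ => key i
    rw [← Finset.mul_sum, Finset.sum_range_sub'] at h3
    linarith [hsq n]

/-- Diagonal formulation of the Hamiltonian-associated-with-a-state lemma:
a probability sequence `q` has finite entropy iff there is a grounded energy
sequence `E` satisfying the Gibbs hypothesis and with finite mean energy. -/
theorem entropy_finite_iff_exists_hamiltonian
    (q : ℕ → ℝ) (hq0 : ∀ n, 0 ≤ q n) (hqsum : ∑' n, q n = 1) :
    (∑' n, ENNReal.ofReal (Real.negMulLog (q n)) < ⊤) ↔
      ∃ E : ℕ → ℝ,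
        (∀ n, 0 ≤ E n) ∧ (∃ n₀, E n₀ = 0) ∧
        (∀ β : ℝ, 0 < β → Summable fun n => Real.exp (-β * E n)) ∧
        Summable (fun n => q n * E n) := by
  have hqs : Summable q := by
    by_contra h
    rw [tsum_eq_zero_of_not_summable h] at hqsum
    exact zero_ne_one hqsum
  have hq1 : ∀ n, q n ≤ 1 := fun n => hqsum ▸ hqs.le_tsum n (fun j _ => hq0 j)
  have ha0 : ∀ n, 0 ≤ Real.negMulLog (q n) := fun n => Real.negMulLog_nonneg (hq0 n) (hq1 n)
  constructor
  · intro h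
    have ha : Summable fun n => Real.negMulLog (q n) := by
      have h2 := ENNReal.summable_toReal h.ne
      simpa only [ENNReal.toReal_ofReal (ha0 _)] using h2
    have hg : Summable fun n : ℕ => ((1 / 2 : ℝ)) ^ n := summable_geometric_two
    obtain ⟨c, hc0, hct, hcs⟩ := exists_growing_weight
      (fun n => Real.negMulLog (q n) + (1 / 2 : ℝ) ^ n)
      (fun n => add_pos_of_nonneg_of_pos (ha0 n) (by positivity)) (ha.add hg)
    have hlog : ∀ n, 0 ≤ -Real.log (q n) := fun n =>
      neg_nonneg.2 (Real.log_nonpos (hq0 n) (hq1 n))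
    let E : ℕ → ℝ := fun n =>
      if n = 0 then 0 else if q n = 0 then (n : ℝ) else c n * (-Real.log (q n))
    have hE0 : ∀ n, 0 ≤ E n := by
      intro n
      simp only [E]
      split_ifs
      · exact le_rfl
      · positivity
      · exact mul_nonneg (hc0 n) (hlog n)
    refine ⟨E, hE0, ⟨0, by simp [E]⟩, ?_, ?_⟩
    · intro β hβ
      have he : Summable fun n : ℕ => Real.exp (-β * n) := by
        have := Real.summable_exp_nat_mul_iff.2 (neg_lt_zero.2 hβ)
        simpa only [mul_comm] using this
      refine Summable.of_norm_bounded_eventually_nat (he.add hqs) ?_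
      filter_upwards [hct.eventually_ge_atTop β⁻¹, Filter.eventually_ge_atTop 1] with n hn hn1
      rw [Real.norm_of_nonneg (Real.exp_pos _).le]
      have hn0 : n ≠ 0 := by omega
      simp only [E, if_neg hn0]
      split_ifs with hqn
      · linarith [hq0 n]
      · have hqp : 0 < q n := lt_of_le_of_ne (hq0 n) (Ne.symm hqn)
        have h1 : 1 ≤ β * c n := by
          have := mul_le_mul_of_nonneg_left hn hβ.le
          rwa [mul_inv_cancel₀ hβ.ne'] at this
        have h2 : Real.exp (-β * (c n * -Real.log (q n))) ≤ q n := by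
          rw [← Real.le_log_iff_exp_le hqp]
          nlinarith [mul_le_mul_of_nonneg_right h1 (hlog n)]
        linarith [Real.exp_pos (-β * (n : ℝ))]
    · refine Summable.of_nonneg_of_le (fun n => mul_nonneg (hq0 n) (hE0 n)) (fun n => ?_) hcs
      have hp : (0 : ℝ) < (1 / 2 : ℝ) ^ n := by positivity
      have hpos : 0 ≤ c n * (Real.negMulLog (q n) + (1 / 2 : ℝ) ^ n) :=
        mul_nonneg (hc0 n) (add_nonneg (ha0 n) hp.le)
      simp only [E]
      split_ifs with h1 h2
      · simpa using hpos
      · rw [h2] at hpos ⊢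
        simpa using hpos
      · have : q n * (c n * -Real.log (q n)) = c n * Real.negMulLog (q n) := by
          rw [Real.negMulLog]; ring
        rw [this]
        exact mul_le_mul_of_nonneg_left (by linarith) (hc0 n)
  · rintro ⟨E, hE0, -, hE, hqE⟩
    have h1 := hE 1 one_pos
    have ha : Summable fun n => Real.negMulLog (q n) := by
      refine Summable.of_nonneg_of_le ha0 (fun n => ?_) (hqE.add h1)
      rcases (hq0 n).eq_or_lt with h | h
      · rw [← h]
        simpa using (Real.exp_pos _).le
      · have h3 := Real.add_one_le_exp (-1 * E n - Real.log (q n))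
        rw [Real.exp_sub, Real.exp_log h, le_div_iff₀ h] at h3
        rw [Real.negMulLog]
        nlinarith
    rw [← ENNReal.ofReal_tsum_of_nonneg ha0 ha]
    exact ENNReal.ofReal_lt_top
end

section
/- Let E : ℕ → ℝ satisfy 0 ≤ E n for all n and the Gibbs hypothesis: for every β > 0 the sequence n ↦ Real.exp (−β * E n) is summable. Assume moreover that E is not bounded above. For β > 0 define the partition function Z β := ∑' n, Real.exp (−β * E n) and the mean energy U β := (∑' n, E n * Real.exp (−β * E n)) / Z β. Then Tendsto (fun β => (β * U β + Real.log (Z β)) / U β) (𝓝[>] (0:ℝ)) (𝓝 0). -/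
open Filter Topology

lemma gibbs_summable_energy (E : ℕ → ℝ) (hE0 : ∀ n, 0 ≤ E n)
    (hGibbs : ∀ β : ℝ, 0 < β → Summable fun n => Real.exp (-β * E n)) (β : ℝ) (hβ : 0 < β) :
    Summable fun n => E n * Real.exp (-β * E n) := by
  refine Summable.of_nonneg_of_le (fun n => mul_nonneg (hE0 n) (Real.exp_pos _).le) (fun n => ?_)
    ((hGibbs (β / 2) (by positivity)).mul_left (2 / β))
  have h1 : β / 2 * E n ≤ Real.exp (β / 2 * E n) := by
    linarith [Real.add_one_le_exp (β / 2 * E n)]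
  have h2 : Real.exp (-(β / 2) * E n) = Real.exp (β / 2 * E n) * Real.exp (-β * E n) := by
    rw [← Real.exp_add]; congr 1; ring
  rw [h2, ← mul_assoc]
  refine mul_le_mul_of_nonneg_right ?_ (Real.exp_pos _).le
  calc E n = 2 / β * (β / 2 * E n) := by field_simp
    _ ≤ _ := mul_le_mul_of_nonneg_left h1 (by positivity)

lemma gibbs_Z_pos (E : ℕ → ℝ)
    (hGibbs : ∀ β : ℝ, 0 < β → Summable fun n => Real.exp (-β * E n)) (β : ℝ) (hβ : 0 < β) :
    0 < ∑' n, Real.exp (-β * E n) :=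
  (hGibbs β hβ).tsum_pos (fun n => (Real.exp_pos _).le) 0 (Real.exp_pos _)

/-- Gibbs variational principle. -/
lemma gibbs_variational (E : ℕ → ℝ) (hE0 : ∀ n, 0 ≤ E n)
    (hGibbs : ∀ β : ℝ, 0 < β → Summable fun n => Real.exp (-β * E n))
    (Z U : ℝ → ℝ)
    (hZ : ∀ β, Z β = ∑' n, Real.exp (-β * E n))
    (hU : ∀ β, U β = (∑' n, E n * Real.exp (-β * E n)) / Z β)
    (β ε : ℝ) (hβ : 0 < β) (hε : 0 < ε) :
    β * U β + Real.log (Z β) ≤ ε * U β + Real.log (Z ε) := by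
  have hZβ : 0 < Z β := by rw [hZ]; exact gibbs_Z_pos E hGibbs β hβ
  have hZε : 0 < Z ε := by rw [hZ]; exact gibbs_Z_pos E hGibbs ε hε
  have hs1 := (hGibbs β hβ).hasSum
  rw [← hZ] at hs1
  have hs2 := (gibbs_summable_energy E hE0 hGibbs β hβ).hasSum
  have hUZ : ∑' n, E n * Real.exp (-β * E n) = U β * Z β := by
    rw [hU, div_mul_cancel₀ _ hZβ.ne']
  rw [hUZ] at hs2
  have hs3 := (hGibbs ε hε).hasSum
  rw [← hZ] at hs3
  set m := (β - ε) * U β with hm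
  have hs4 := ((hs1.mul_left (1 - m)).add (hs2.mul_left (β - ε))).mul_left (Real.exp m)
  have key := hasSum_le (fun n => ?_) hs4 hs3
  · have h5 : Real.exp m * Z β ≤ Z ε := by
      refine le_trans (le_of_eq ?_) key
      rw [hm]; ring
    have h6 := Real.log_le_log (by positivity) h5
    rw [Real.log_mul (Real.exp_pos _).ne' hZβ.ne', Real.log_exp] at h6
    rw [hm] at h6
    linarith
  · have h7 : Real.exp (-ε * E n)
        = Real.exp m * (Real.exp ((β - ε) * E n - m) * Real.exp (-β * E n)) := by
      rw [← Real.exp_add, ← Real.exp_add]; congr 1; ring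
    rw [h7]
    refine mul_le_mul_of_nonneg_left ?_ (Real.exp_pos _).le
    have h8 := mul_le_mul_of_nonneg_right (Real.add_one_le_exp ((β - ε) * E n - m))
      (Real.exp_pos (-β * E n)).le
    linarith

lemma gibbs_U_ge (E : ℕ → ℝ) (hE0 : ∀ n, 0 ≤ E n)
    (hGibbs : ∀ β : ℝ, 0 < β → Summable fun n => Real.exp (-β * E n))
    (Z U : ℝ → ℝ)
    (hZ : ∀ β, Z β = ∑' n, Real.exp (-β * E n))
    (hU : ∀ β, U β = (∑' n, E n * Real.exp (-β * E n)) / Z β) :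
    Tendsto U (𝓝[>] (0 : ℝ)) atTop := by
  rw [tendsto_atTop]
  intro M
  have hEt : ∀ᶠ n in atTop, M + 1 ≤ E n := by
    have h := (hGibbs 1 one_pos).tendsto_atTop_zero
    filter_upwards [h.eventually_lt_const (Real.exp_pos (-(M + 1)))] with n hn
    rw [Real.exp_lt_exp] at hn
    linarith
  obtain ⟨n0, hn0⟩ := eventually_atTop.1 hEt
  obtain ⟨K, hK⟩ := exists_nat_gt (-(∑ n ∈ Finset.range n0, (E n - M)))
  have hpos : 0 < ∑ n ∈ Finset.range (n0 + K), (E n - M) * Real.exp (-0 * E n) := by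
    simp only [neg_zero, zero_mul, Real.exp_zero, mul_one]
    rw [Finset.sum_range_add]
    have : (K : ℝ) ≤ ∑ x ∈ Finset.range K, (E (n0 + x) - M) := by
      calc (K : ℝ) = ∑ x ∈ Finset.range K, (1 : ℝ) := by simp
        _ ≤ _ := Finset.sum_le_sum fun i _ => by linarith [hn0 (n0 + i) (by omega)]
    linarith
  have hcont : Continuous fun β : ℝ =>
      ∑ n ∈ Finset.range (n0 + K), (E n - M) * Real.exp (-β * E n) := by fun_prop
  have hev := (hcont.tendsto 0).eventually_const_lt hpos
  filter_upwards [nhdsWithin_le_nhds hev, self_mem_nhdsWithin] with β h1 hβ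
  have hβ : 0 < β := hβ
  have hZβ : 0 < Z β := by rw [hZ]; exact gibbs_Z_pos E hGibbs β hβ
  rw [hU, le_div_iff₀ hZβ]
  have hs1 := hGibbs β hβ
  have hs2 := gibbs_summable_energy E hE0 hGibbs β hβ
  have hs := hs2.hasSum.sub (hs1.hasSum.mul_left M)
  have h2 := sum_le_hasSum (Finset.range (n0 + K)) (fun n hn => ?_) hs
  · rw [← hZ] at h2
    have h3 : ∑ n ∈ Finset.range (n0 + K), (E n - M) * Real.exp (-β * E n)
      = ∑ n ∈ Finset.range (n0 + K), (E n * Real.exp (-β * E n) - M * Real.exp (-β * E n)) :=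
      Finset.sum_congr rfl fun n _ => by ring
    linarith
  · have hn' : n0 ≤ n := by
      have : ¬ n < n0 + K := by simpa using hn
      omega
    have := mul_nonneg (by linarith [hn0 n hn'] : 0 ≤ E n - M) (Real.exp_pos (-β * E n)).le
    linarith



/-- The entropy of the Gibbs state is asymptotically negligible compared
with its energy: `(β U(β) + log Z(β)) / U(β) → 0` as `β → 0⁺`, for an
unbounded nonnegative energy sequence satisfying the Gibbs hypothesis. -/
theorem gibbs_entropy_over_energy_tendsto_zero
    (E : ℕ → ℝ) (hE0 : ∀ n, 0 ≤ E n)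
    (hGibbs : ∀ β : ℝ, 0 < β → Summable fun n => Real.exp (-β * E n))
    (hub : ¬ BddAbove (Set.range E))
    (Z U : ℝ → ℝ)
    (hZ : ∀ β, Z β = ∑' n, Real.exp (-β * E n))
    (hU : ∀ β, U β = (∑' n, E n * Real.exp (-β * E n)) / Z β) :
    Tendsto (fun β => (β * U β + Real.log (Z β)) / U β) (𝓝[>] (0 : ℝ)) (𝓝 0) := by
  have hUt := gibbs_U_ge E hE0 hGibbs Z U hZ hU
  rw [Metric.tendsto_nhds]
  intro δ hδ
  have hε : 0 < δ / 2 := by positivity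
  filter_upwards [self_mem_nhdsWithin, hUt.eventually_ge_atTop (E 0), hUt.eventually_ge_atTop 1,
    hUt.eventually_gt_atTop (Real.log (Z (δ / 2)) / (δ / 2))] with β hβ h0 h1 h2
  have hβ : 0 < β := hβ
  have hUp : 0 < U β := by linarith
  have hv := gibbs_variational E hE0 hGibbs Z U hZ hU β (δ / 2) hβ hε
  have hlow : 0 ≤ β * U β + Real.log (Z β) := by
    have h3 : Real.exp (-β * E 0) ≤ Z β := by
      rw [hZ]
      exact (hGibbs β hβ).le_tsum 0 fun _ _ => (Real.exp_pos _).le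
    have h4 := Real.log_le_log (Real.exp_pos _) h3
    rw [Real.log_exp] at h4
    have := mul_le_mul_of_nonneg_left h0 hβ.le
    linarith
  rw [div_lt_iff₀ hε] at h2
  rw [Real.dist_eq, sub_zero, abs_of_nonneg (div_nonneg hlow hUp.le), div_lt_iff₀ hUp]
  linarith
end

section
/- Let H be a complex inner product space, let (e n)_{n ∈ ℕ} be an orthonormal family in H, let N be a natural number, and let (v i)_{i ∈ Fin N} be an orthonormal family in H. Let λ : ℕ → ℝ be nonincreasing with 0 ≤ λ n for all n. Then ∑_{i ∈ Fin N} ∑' n, λ n * ‖⟪e n, v i⟫‖² ≤ ∑_{n ∈ Finset.range N} λ n. -/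
open scoped InnerProductSpace

/-- Infinite-dimensional Schur–Horn inequality: for a positive compact operator
`M = ∑ₙ λₙ |eₙ⟩⟨eₙ|` with nonincreasing nonnegative eigenvalue sequence `λ`,
the sum over an orthonormal family `v₀, …, v_{N−1}` of the diagonal entries
`⟨vᵢ, M vᵢ⟩ = ∑' n, λ n ‖⟪e n, v i⟫‖²` is at most `λ₀ + ⋯ + λ_{N−1}`. -/
theorem schur_horn_infinite_dim
    {H : Type*} [NormedAddCommGroup H] [InnerProductSpace ℂ H]
    (e : ℕ → H) (he : Orthonormal ℂ e)
    (N : ℕ) (v : Fin N → H) (hv : Orthonormal ℂ v)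
    (lam : ℕ → ℝ) (hlam0 : ∀ n, 0 ≤ lam n) (hlammono : ∀ n, lam (n + 1) ≤ lam n) :
    ∑ i : Fin N, ∑' n : ℕ, lam n * ‖⟪e n, v i⟫_ℂ‖ ^ 2
      ≤ ∑ n ∈ Finset.range N, lam n := by
  have hanti : Antitone lam := antitone_nat_of_succ_le hlammono
  have hsum : ∀ i : Fin N, Summable fun n : ℕ => lam n * ‖⟪e n, v i⟫_ℂ‖ ^ 2 := by
    intro i
    refine Summable.of_nonneg_of_le (fun n => mul_nonneg (hlam0 n) (sq_nonneg _))
      (fun n => ?_) ((he.inner_products_summable (v i)).mul_left (lam 0))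
    exact mul_le_mul_of_nonneg_right (hanti (Nat.zero_le n)) (sq_nonneg _)
  rw [← Summable.tsum_finsetSum (fun i _ => hsum i)]
  refine Real.tsum_le_of_sum_range_le
    (fun n => Finset.sum_nonneg fun i _ => mul_nonneg (hlam0 n) (sq_nonneg _)) fun m => ?_
  set c : ℕ → ℝ := fun n => ∑ i : Fin N, ‖⟪e n, v i⟫_ℂ‖ ^ 2 with hc
  have hc0 : ∀ n, 0 ≤ c n := fun n => Finset.sum_nonneg fun i _ => sq_nonneg _
  have hc1 : ∀ n, c n ≤ 1 := by
    intro n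
    have h := hv.sum_inner_products_le (e n) (s := Finset.univ)
    rw [he.1 n, one_pow] at h
    refine le_trans (le_of_eq ?_) h
    exact Finset.sum_congr rfl fun i _ => by rw [norm_inner_symm]
  have hcN : ∑ n ∈ Finset.range m, c n ≤ N := by
    rw [hc, Finset.sum_comm]
    calc _ ≤ ∑ i : Fin N, (1 : ℝ) := Finset.sum_le_sum fun i _ => by
            have h := he.sum_inner_products_le (v i) (s := Finset.range m)
            rwa [hv.1 i, one_pow] at h
      _ = N := by simp
  have hpt : ∀ n, ∑ i : Fin N, lam n * ‖⟪e n, v i⟫_ℂ‖ ^ 2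
      ≤ lam N * c n + if n < N then lam n - lam N else 0 := by
    intro n
    rw [← Finset.mul_sum]
    change lam n * c n ≤ _
    split_ifs with h
    · nlinarith [hanti h.le, hc1 n]
    · nlinarith [hanti (not_lt.mp h), hc0 n]
  have hind : ∑ n ∈ Finset.range m, (if n < N then lam n - lam N else 0)
      ≤ ∑ n ∈ Finset.range N, (lam n - lam N) := by
    rw [← Finset.sum_filter]
    refine Finset.sum_le_sum_of_subset_of_nonneg (fun n hn => ?_) fun n hn _ => ?_
    · exact Finset.mem_range.mpr (Finset.mem_filter.mp hn).2
    · exact sub_nonneg.mpr (hanti (Finset.mem_range.mp hn).le)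
  have h1 := Finset.sum_le_sum (s := Finset.range m) fun n _ => hpt n
  rw [Finset.sum_add_distrib, ← Finset.mul_sum] at h1
  rw [Finset.sum_sub_distrib, Finset.sum_const, Finset.card_range, nsmul_eq_mul] at hind
  have h2 := mul_le_mul_of_nonneg_left hcN (hlam0 N)
  linarith
end

section
/- Let a : ℕ → ℝ be a summable sequence of nonnegative real numbers (0 ≤ a n for all n, Summable a), and let c > 1 be a real number. Then there exists a sequence b : ℕ → ℝ such that b n ≥ 1 for all n, Tendsto b atTop atTop, the sequence n ↦ a n * b n is summable, and ∑' n, a n * b n ≤ c * ∑' n, a n. -/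
open Filter

theorem exists_weights_aux (a : ℕ → ℝ) (ha0 : ∀ n, 0 < a n) (ha : Summable a) :
    ∃ w : ℕ → ℝ, (∀ n, 0 < w n) ∧ Tendsto w atTop atTop ∧ Summable (fun n => a n * w n) := by
  obtain ⟨r, hr⟩ : ∃ r : ℕ → ℝ, r = fun n => ∑' k, a (k + n) := ⟨_, rfl⟩
  have hs : ∀ n, Summable (fun k => a (k + n)) := fun n => (summable_nat_add_iff n).2 ha
  have hpos : ∀ n, 0 < r n := fun n => by
    rw [hr]
    exact (hs n).tsum_pos (fun k => (ha0 _).le) 0 (ha0 _)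
  have hrec : ∀ n, r n = a n + r (n + 1) := fun n => by
    rw [hr]
    simp only
    rw [(hs n).tsum_eq_zero_add]
    simp only [zero_add]
    congr 2
    ext k
    congr 1
    ring
  have hlim : Tendsto r atTop (nhds 0) := by
    rw [hr]
    exact tendsto_sum_nat_add a
  have hsq : ∀ n, 0 < √(r n) := fun n => Real.sqrt_pos.2 (hpos n)
  refine ⟨fun n => (√(r n) + √(r (n + 1)))⁻¹, fun n => ?_, ?_, ?_⟩
  · have := hsq n
    have := hsq (n + 1)
    positivity
  · apply Tendsto.inv_tendsto_nhdsGT_zero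
    rw [tendsto_nhdsWithin_iff]
    constructor
    · have h1 : Tendsto (fun n => √(r n)) atTop (nhds 0) := by
        simpa using hlim.sqrt
      simpa using h1.add (h1.comp (tendsto_add_atTop_nat 1))
    · exact Eventually.of_forall fun n => add_pos (hsq n) (hsq (n + 1))
  · have key : ∀ n, a n * (√(r n) + √(r (n + 1)))⁻¹ = √(r n) - √(r (n + 1)) := fun n => by
      have h1 := hsq n
      have h2 := hsq (n + 1)
      have h3 := Real.sq_sqrt (hpos n).le
      have h4 := Real.sq_sqrt (hpos (n + 1)).le
      have h5 := hrec n
      rw [mul_inv_eq_iff_eq_mul₀ (by positivity)]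
      nlinarith
    apply summable_of_sum_range_le (c := √(r 0))
    · intro n
      have h1 := hsq n
      have h2 := hsq (n + 1)
      have h3 := ha0 n
      positivity
    · intro n
      simp only [key]
      rw [Finset.sum_range_sub']
      linarith [hsq n]

/-- Appendix series lemma: any convergent series of nonnegative terms can be
multiplied termwise by weights `b n ≥ 1` tending to infinity while increasing
the sum by at most a factor `c > 1`. -/
theorem exists_weights_tendsto_atTop
    (a : ℕ → ℝ) (ha0 : ∀ n, 0 ≤ a n) (ha : Summable a)
    (c : ℝ) (hc : 1 < c) :
    ∃ b : ℕ → ℝ, (∀ n, 1 ≤ b n) ∧ Tendsto b atTop atTop ∧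
      Summable (fun n => a n * b n) ∧ ∑' n, a n * b n ≤ c * ∑' n, a n := by
  obtain ⟨w, hw0, hw, hws⟩ := exists_weights_aux (fun n => a n + (1 / 2) ^ n)
    (fun n => add_pos_of_nonneg_of_pos (ha0 n) (by positivity))
    (ha.add summable_geometric_two)
  have hs : Summable (fun n => a n * w n) :=
    hws.of_nonneg_of_le (fun n => mul_nonneg (ha0 n) (hw0 n).le) fun n =>
      mul_le_mul_of_nonneg_right (le_add_of_nonneg_right (by positivity)) (hw0 n).le
  have hT : 0 ≤ ∑' n, a n * w n := tsum_nonneg fun n => mul_nonneg (ha0 n) (hw0 n).le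
  obtain ⟨d, hd, hdT⟩ : ∃ d : ℝ, 0 < d ∧ d * ∑' n, a n * w n ≤ (c - 1) * ∑' n, a n := by
    rcases (tsum_nonneg ha0).eq_or_lt with h | h
    · have h0 : a = 0 := by
        have := ha.hasSum
        rw [← h] at this
        exact (hasSum_zero_iff_of_nonneg ha0).1 this
      exact ⟨1, one_pos, by simp [h0]⟩
    · have hp : 0 < (c - 1) * ∑' n, a n := mul_pos (by linarith) h
      refine ⟨(c - 1) * (∑' n, a n) / (∑' n, a n * w n + 1), by positivity, ?_⟩
      rw [div_mul_eq_mul_div, div_le_iff₀ (by positivity)]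
      nlinarith
  have he : (fun n => a n * (1 + d * w n)) = fun n => a n + d * (a n * w n) := by
    ext n
    ring
  refine ⟨fun n => 1 + d * w n, fun n => ?_, ?_, ?_, ?_⟩
  · have := mul_pos hd (hw0 n)
    linarith
  · exact tendsto_atTop_add_const_left _ _ (hw.const_mul_atTop hd)
  · rw [he]
    exact ha.add (hs.mul_left d)
  · simp only [he]
    rw [ha.tsum_add (hs.mul_left d), tsum_mul_left]
    linarith
end

section
/- Let a : ℕ → ℝ be a probability sequence (0 ≤ a n for all n and ∑' n, a n = 1) all of whose tail sums are positive: ∑' m, a (n + m) > 0 for every n ∈ ℕ. Then, in the extended nonnegative reals, ∑' n, ENNReal.ofReal (a n * Real.logb 2 (∑' m, a (n + m))⁻¹) ≤ 4; that is, ∑_{n=0}^∞ a_n · log₂(1/∑_{m ≥ n} a_m) ≤ 4. -/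
/-- Key quantitative estimate in the proof of the appendix series lemma:
for a probability sequence `a` with positive tail sums,
`∑ₙ aₙ · log₂(1/∑_{m ≥ n} aₘ) ≤ 4`. -/
theorem sum_mul_logb_inv_tail_le_four
    (a : ℕ → ℝ) (ha0 : ∀ n, 0 ≤ a n) (hasum : ∑' n, a n = 1)
    (htail : ∀ n : ℕ, 0 < ∑' m, a (n + m)) :
    ∑' n, ENNReal.ofReal (a n * Real.logb 2 ((∑' m, a (n + m))⁻¹)) ≤ 4 := by
  have hs : Summable a := by
    by_contra h
    rw [tsum_eq_zero_of_not_summable h] at hasum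
    norm_num at hasum
  obtain ⟨T, hT⟩ : ∃ T : ℕ → ℝ, ∀ n, T n = ∑' m, a (n + m) := ⟨_, fun n => rfl⟩
  simp only [← hT] at htail ⊢
  have hT0 : T 0 = 1 := by rw [hT]; simpa using hasum
  have hstep : ∀ n, T n = a n + T (n + 1) := by
    intro n
    have h1 : Summable (fun m => a (n + m)) := by
      simpa [add_comm] using (summable_nat_add_iff n).2 hs
    rw [hT, hT, h1.tsum_eq_zero_add]
    simp only [add_zero, add_assoc, add_comm, add_left_comm]
  have hT1 : ∀ n, T n ≤ 1 := by
    intro n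
    induction n with
    | zero => exact hT0.le
    | succ n ih => linarith [hstep n, ha0 n]
  have hl2 : (1 : ℝ) / 2 < Real.log 2 := by linarith [Real.log_two_gt_d9]
  have hlog : ∀ n, Real.log (T n) ≤ 0 := fun n => Real.log_nonpos (htail n).le (hT1 n)
  have hterm : ∀ n, a n * Real.logb 2 (T n)⁻¹ = a n * (-Real.log (T n)) / Real.log 2 := by
    intro n
    rw [Real.logb, Real.log_inv, mul_div_assoc]
  have hsum : ∀ N, ∑ n ∈ Finset.range N, a n * (-Real.log (T n))
      ≤ 1 - (T N - T N * Real.log (T N)) := by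
    intro N
    induction N with
    | zero => simp [hT0]
    | succ N ih =>
      rw [Finset.sum_range_succ]
      have hx := htail N
      have hy := htail (N + 1)
      have h := Real.log_le_sub_one_of_pos (div_pos hx hy)
      rw [Real.log_div hx.ne' hy.ne'] at h
      have h2 := mul_le_mul_of_nonneg_left h hy.le
      have h3 : T (N + 1) * (T N / T (N + 1) - 1) = T N - T (N + 1) := by
        field_simp
      rw [h3] at h2
      have h4 : a N = T N - T (N + 1) := by linarith [hstep N]
      rw [h4]
      nlinarith
  apply ENNReal.tsum_le_of_sum_range_le
  intro N
  rw [← ENNReal.ofReal_sum_of_nonneg]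
  · apply ENNReal.ofReal_le_of_le_toReal
    simp only [hterm]
    rw [← Finset.sum_div, div_le_iff₀ (by linarith)]
    have h1 := hsum N
    have h2 := mul_nonneg (htail N).le (neg_nonneg.2 (hlog N))
    have h3 : (4 : ENNReal).toReal = 4 := by simp
    rw [h3]
    linarith [htail N]
  · intro n _
    rw [hterm]
    exact div_nonneg (mul_nonneg (ha0 n) (neg_nonneg.2 (hlog n))) (by linarith)
end

section
/- Let w : ℕ → ℝ be a probability sequence all of whose strict tails are positive: for every N ∈ ℕ, δ N := ∑' x, w (N + 1 + x) > 0. Let μ : ℕ → ℕ → ℝ be a family such that μ x is a probability sequence for every x, and define the mixture ρ n := ∑' x, w x * μ x n, which is again a probability sequence. Assume the mixture has finite entropy: ∑' n, ENNReal.ofReal (Real.negMulLog (ρ n)) < ⊤. For each N define the tail mixture ω N n := (δ N)⁻¹ * ∑' x, w (N + 1 + x) * μ (N + 1 + x) n. Then Tendsto (fun N => ENNReal.ofReal (δ N) * ∑' n, ENNReal.ofReal (Real.negMulLog (ω N n))) atTop (𝓝 0). -/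
open Filter Topology

/-- Pointwise domination of the entropy function below a given value. -/
lemma negMulLog_dominated {t r : ℝ} (ht : 0 ≤ t) (htr : t ≤ r) (hr : r ≤ 1) :
    Real.negMulLog t ≤ r + Real.negMulLog r := by
  rcases eq_or_lt_of_le ht with h | h
  · subst h
    have := Real.negMulLog_nonneg htr hr
    simp only [Real.negMulLog_zero]
    linarith
  · have hr0 : 0 < r := lt_of_lt_of_le h htr
    have h1 : Real.log (r / t) ≤ r / t - 1 := Real.log_le_sub_one_of_pos (by positivity)
    rw [Real.log_div hr0.ne' h.ne'] at h1
    have h2 : t * (Real.log r - Real.log t) ≤ t * (r / t - 1) :=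
      mul_le_mul_of_nonneg_left h1 ht
    have h3 : t * (r / t - 1) = r - t := by field_simp
    have h4 : Real.log r ≤ 0 := Real.log_nonpos hr0.le hr
    simp only [Real.negMulLog]
    nlinarith

/-- Classical formulation of `δ_N S(ω_N) → 0`: if a countable mixture
`ρ = ∑ₓ w x • μ x` has finite entropy, then the weight `δ N` of the rare part
beyond the first `N + 1` components, multiplied by the entropy of the
renormalized rare part `ω N`, vanishes as `N → ∞`. -/
theorem rare_part_weighted_entropy_tendsto_zero
    (w : ℕ → ℝ) (hw0 : ∀ x, 0 ≤ w x) (hwsum : ∑' x, w x = 1)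
    (μ : ℕ → ℕ → ℝ) (hμ0 : ∀ x n, 0 ≤ μ x n) (hμsum : ∀ x, ∑' n, μ x n = 1)
    (δ : ℕ → ℝ) (hδ : ∀ N, δ N = ∑' x, w (N + 1 + x)) (hδpos : ∀ N, 0 < δ N)
    (ρ : ℕ → ℝ) (hρ : ∀ n, ρ n = ∑' x, w x * μ x n)
    (hent : ∑' n, ENNReal.ofReal (Real.negMulLog (ρ n)) < ⊤)
    (ω : ℕ → ℕ → ℝ)
    (hω : ∀ N n, ω N n = (δ N)⁻¹ * ∑' x, w (N + 1 + x) * μ (N + 1 + x) n) :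
    Tendsto (fun N => ENNReal.ofReal (δ N) *
        ∑' n, ENNReal.ofReal (Real.negMulLog (ω N n))) atTop (𝓝 0) := by
  have hws : Summable w := by
    by_contra h
    rw [tsum_eq_zero_of_not_summable h] at hwsum
    exact zero_ne_one hwsum
  have hμs : ∀ x, Summable (μ x) := by
    intro x
    by_contra h
    have := hμsum x
    rw [tsum_eq_zero_of_not_summable h] at this
    exact zero_ne_one this
  have hμ1 : ∀ x n, μ x n ≤ 1 := fun x n =>
    (hμsum x) ▸ (hμs x).le_tsum n (fun j _ => hμ0 x j)
  have hnn : ∀ n x, 0 ≤ w x * μ x n := fun n x => mul_nonneg (hw0 x) (hμ0 x n)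
  have hle : ∀ n x, w x * μ x n ≤ w x := fun n x =>
    mul_le_of_le_one_right (hw0 x) (hμ1 x n)
  have hs : ∀ n, Summable (fun x => w x * μ x n) := fun n =>
    Summable.of_nonneg_of_le (hnn n) (hle n) hws
  have hρ1 : ∀ n, ρ n ≤ 1 := by
    intro n
    rw [hρ, ← hwsum]
    exact (hs n).tsum_le_tsum (hle n) hws
  have hδ1 : ∀ N, δ N ≤ 1 := by
    intro N
    rw [hδ, ← hwsum]
    exact tsum_comp_le_tsum_of_inj hws hw0 (add_right_injective (N + 1))
  set t : ℕ → ℕ → ℝ := fun N n => ∑' x, w (N + 1 + x) * μ (N + 1 + x) n with ht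
  have ht0 : ∀ N n, 0 ≤ t N n := fun N n => tsum_nonneg (fun x => hnn n _)
  have htρ : ∀ N n, t N n ≤ ρ n := by
    intro N n
    rw [hρ]
    exact tsum_comp_le_tsum_of_inj (hs n) (hnn n) (add_right_injective (N + 1))
  have htlim : ∀ n, Tendsto (fun N => t N n) atTop (𝓝 0) := by
    intro n
    have h := (tendsto_sum_nat_add (fun x => w x * μ x n)).comp (tendsto_add_atTop_nat 1)
    refine h.congr (fun N => ?_)
    simp only [ht, Function.comp]
    exact tsum_congr (fun x => by rw [add_comm x])
  have hρsum : ∑' n, ENNReal.ofReal (ρ n) = 1 := by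
    have h1 : ∀ n, ENNReal.ofReal (ρ n) = ∑' x, ENNReal.ofReal (w x * μ x n) := fun n => by
      rw [hρ, ENNReal.ofReal_tsum_of_nonneg (hnn n) (hs n)]
    simp_rw [h1]
    rw [ENNReal.tsum_comm]
    have h2 : ∀ x, ∑' n, ENNReal.ofReal (w x * μ x n) = ENNReal.ofReal (w x) := fun x => by
      rw [← ENNReal.ofReal_tsum_of_nonneg (fun n => hnn n x) ((hμs x).mul_left _),
        tsum_mul_left, hμsum, mul_one]
    simp_rw [h2]
    rw [← ENNReal.ofReal_tsum_of_nonneg hw0 hws, hwsum, ENNReal.ofReal_one]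
  have key : Tendsto (fun N => ∑' n, ENNReal.ofReal (Real.negMulLog (t N n))) atTop (𝓝 0) := by
    have h := MeasureTheory.tendsto_lintegral_of_dominated_convergence
      (μ := (MeasureTheory.Measure.count : MeasureTheory.Measure ℕ))
      (F := fun N n => ENNReal.ofReal (Real.negMulLog (t N n))) (f := fun _ => 0)
      (fun n => ENNReal.ofReal (ρ n) + ENNReal.ofReal (Real.negMulLog (ρ n)))
      (fun N => measurable_from_top)
      (fun N => Eventually.of_forall fun n => by
        have h0 : 0 ≤ ρ n := (ht0 N n).trans (htρ N n)
        beta_reduce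
        rw [← ENNReal.ofReal_add h0 (Real.negMulLog_nonneg h0 (hρ1 n))]
        exact ENNReal.ofReal_le_ofReal (negMulLog_dominated (ht0 N n) (htρ N n) (hρ1 n)))
      (by
        rw [MeasureTheory.lintegral_count, ENNReal.tsum_add, hρsum]
        exact ENNReal.add_ne_top.2 ⟨ENNReal.one_ne_top, hent.ne⟩)
      (Eventually.of_forall fun n => by
        have h1 := ENNReal.tendsto_ofReal
          ((Real.continuous_negMulLog.tendsto 0).comp (htlim n))
        simpa [Function.comp_def] using h1)
    simpa [MeasureTheory.lintegral_count] using h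
  refine tendsto_of_tendsto_of_tendsto_of_le_of_le tendsto_const_nhds key
    (fun _ => zero_le) (fun N => ?_)
  show _ * _ ≤ _
  rw [← ENNReal.tsum_mul_left]
  refine ENNReal.tsum_le_tsum (fun n => ?_)
  rw [← ENNReal.ofReal_mul (hδpos N).le]
  refine ENNReal.ofReal_le_ofReal ?_
  have hd := hδpos N
  have hω' : ω N n = (δ N)⁻¹ * t N n := hω N n
  rw [hω', Real.negMulLog_mul]
  have h1 : Real.log (δ N) ≤ 0 := Real.log_nonpos hd.le (hδ1 N)
  have h2 : δ N * (t N n * Real.negMulLog (δ N)⁻¹ + (δ N)⁻¹ * Real.negMulLog (t N n))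
      = t N n * Real.log (δ N) + Real.negMulLog (t N n) := by
    rw [Real.negMulLog, Real.log_inv]
    field_simp
  rw [h2]
  have := mul_nonpos_of_nonneg_of_nonpos (ht0 N n) h1
  linarith
end
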